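/- Let M = (Q, Σ, δ, q₀, F) be an NFA in which every state is accessible and co-accessible. Then L(M) has polynomial growth if and only if for every state q ∈ Q the language L_q is commutative. -/

import Mathlib

open Computability

/-- The number of words of length `m` in the language `L`. -/
noncomputable def Language.growthCount {α : Type*} (L : Language α) (m : ℕ) : ℕ :=
  {w ∈ (L : Set (List α)) | w.length = m}.ncard

/-- `L` has polynomial growth: there is a polynomial `p` with `|L ∩ Σ^m| ≤ p(m)` for all `m`. -/
def Language.HasPolynomialGrowth {α : Type*} (L : Language α) : Prop :=
  ∃ p : Polynomial ℕ, ∀ m : ℕ, L.growthCount m ≤ p.eval m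

/-- `L` is commutative: `L ⊆ u*` for some word `u`. -/
def Language.IsCommutativeLang {α : Type*} (L : Language α) : Prop :=
  ∃ u : List α, L ≤ ({u} : Language α)∗

/-- The state `q` of the NFA `M` is accessible: it is reachable from the start by some word. -/
def NFA.Accessible {α σ : Type*} (M : NFA α σ) (q : σ) : Prop :=
  ∃ w : List α, q ∈ M.eval w

/-- The state `q` is co-accessible: some accepting state is reachable from `q` by some word. -/
def NFA.CoAccessible {α σ : Type*} (M : NFA α σ) (q : σ) : Prop :=
  ∃ w : List α, (M.evalFrom {q} w ∩ M.accept).Nonempty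

/-- `L_q`: the language of words that can take `M` from state `q` back to state `q`. -/
def NFA.loopLang {α σ : Type*} (M : NFA α σ) (q : σ) : Language α :=
  {w | q ∈ M.evalFrom {q} w}

namespace List

/-- A word that commutes with a nonempty word `w` is a prefix of all large powers of `w`. -/
theorem prefix_flatten_replicate_of_append_comm {α : Type*} {w x : List α}
    (h : x ++ w = w ++ x) {n : ℕ} (hn : x.length ≤ n * w.length) :
    x <+: (replicate n w).flatten := by
  have hcomm : ∀ n : ℕ, x ++ (replicate n w).flatten = (replicate n w).flatten ++ x := by
    intro n
    induction n with
    | zero => simp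
    | succ n ih =>
      rw [replicate_succ, flatten_cons, ← append_assoc, h, append_assoc, ih, append_assoc]
  refine prefix_of_prefix_length_le (l₃ := (replicate n w).flatten ++ x) ?_
    (prefix_append _ _) (by simpa using hn)
  rw [← hcomm]
  exact prefix_append _ _

/-- The words commuting with a nonempty word are the powers of a single word. -/
theorem exists_forall_mem_kstar_of_append_comm {α : Type*} {w : List α} (hw : w ≠ []) :
    ∃ u : List α, ∀ x : List α, x ++ w = w ++ x → x ∈ ({u} : Language α)∗ := by
  classical
  have hex : ∃ n, ∃ u : List α, u ≠ [] ∧ u ++ w = w ++ u ∧ u.length = n := ⟨_, w, hw, rfl, rfl⟩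
  obtain ⟨u, hu, huw, hlen⟩ := Nat.find_spec hex
  refine ⟨u, fun x hx => ?_⟩
  induction hl : x.length using Nat.strong_induction_on generalizing x with
  | _ l ih =>
    by_cases hx0 : x = []
    · subst hx0
      exact Language.nil_mem_kstar _
    have hle : u.length ≤ x.length := hlen ▸ Nat.find_min' hex ⟨x, hx0, hx, rfl⟩
    have hwpos : 0 < w.length := length_pos_iff.2 hw
    have hxp := prefix_flatten_replicate_of_append_comm hx
      (n := x.length) (Nat.le_mul_of_pos_right _ hwpos)
    have hup := prefix_flatten_replicate_of_append_comm huw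
      (n := x.length) (hle.trans (Nat.le_mul_of_pos_right _ hwpos))
    obtain ⟨y, rfl⟩ := prefix_of_prefix_length_le hup hxp hle
    have hy : y ++ w = w ++ y := by
      apply append_cancel_left (as := u)
      rw [← append_assoc, hx, ← append_assoc, ← huw, append_assoc]
    have hupos : 0 < u.length := length_pos_iff.2 hu
    have hyu := ih y.length (by rw [← hl, length_append]; omega) y hy rfl
    obtain ⟨L, rfl, hL⟩ := Language.mem_kstar.1 hyu
    refine Language.mem_kstar.2 ⟨u :: L, by simp, ?_⟩
    intro z hz
    rcases mem_cons.1 hz with rfl | hz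
    · rfl
    · exact hL z hz

end List

namespace Language

variable {α : Type*}

theorem isCommutativeLang_of_append_comm {L : Language α}
    (h : ∀ x ∈ L, ∀ y ∈ L, x ++ y = y ++ x) : L.IsCommutativeLang := by
  by_cases hL : ∃ w ∈ L, w ≠ []
  · obtain ⟨w, hwL, hw⟩ := hL
    obtain ⟨u, hu⟩ := List.exists_forall_mem_kstar_of_append_comm hw
    exact ⟨u, fun x hx => hu x (h x hx w hwL)⟩
  · push Not at hL
    refine ⟨[], fun x hx => ?_⟩
    rw [hL x hx]
    exact nil_mem_kstar _

theorem finite_setOf_mem_and_length_eq [Finite α] (L : Language α) (m : ℕ) :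
    {w ∈ (L : Set (List α)) | w.length = m}.Finite :=
  (List.finite_length_eq α m).subset fun _ hw => hw.2

theorem growthCount_mono [Finite α] {L K : Language α} (h : L ≤ K) (m : ℕ) :
    L.growthCount m ≤ K.growthCount m :=
  Set.ncard_le_ncard (fun _ hw => ⟨h hw.1, hw.2⟩) (K.finite_setOf_mem_and_length_eq m)

theorem HasPolynomialGrowth.mono [Finite α] {L K : Language α} (hK : K.HasPolynomialGrowth)
    (h : L ≤ K) : L.HasPolynomialGrowth := by
  obtain ⟨p, hp⟩ := hK
  exact ⟨p, fun m => (growthCount_mono h m).trans (hp m)⟩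

theorem HasPolynomialGrowth.iSup [Finite α] {ι : Type*} [Finite ι] {L : ι → Language α}
    (h : ∀ i, (L i).HasPolynomialGrowth) : (⨆ i, L i).HasPolynomialGrowth := by
  have := Fintype.ofFinite ι
  choose p hp using h
  refine ⟨∑ i, p i, fun m => ?_⟩
  rw [Polynomial.eval_finsetSum]
  refine le_trans ?_ (Finset.sum_le_sum fun i _ => hp i m)
  refine le_trans (Set.ncard_le_ncard (t := ⋃ i, {w ∈ (L i : Set (List α)) | w.length = m}) ?_
    (Set.finite_iUnion fun i => (L i).finite_setOf_mem_and_length_eq m)) ?_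
  · rintro w ⟨hw, hm⟩
    obtain ⟨i, hi⟩ := mem_iSup.1 hw
    exact Set.mem_iUnion.2 ⟨i, hi, hm⟩
  · exact Set.ncard_iUnion_le_of_fintype _

theorem HasPolynomialGrowth.add [Finite α] {L K : Language α} (hL : L.HasPolynomialGrowth)
    (hK : K.HasPolynomialGrowth) : (L + K).HasPolynomialGrowth := by
  refine (HasPolynomialGrowth.iSup (L := fun b : Bool => cond b L K) (by simp [hL, hK])).mono ?_
  rintro w (hw | hw)
  · exact mem_iSup.2 ⟨true, hw⟩
  · exact mem_iSup.2 ⟨false, hw⟩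

theorem HasPolynomialGrowth.mul [Finite α] {L K : Language α} (hL : L.HasPolynomialGrowth)
    (hK : K.HasPolynomialGrowth) : (L * K).HasPolynomialGrowth := by
  obtain ⟨p, hp⟩ := hL
  obtain ⟨q, hq⟩ := hK
  have hmono : ∀ (r : Polynomial ℕ) {i m : ℕ}, i ≤ m → r.eval i ≤ r.eval m := by
    intro r i m him
    rw [Polynomial.eval_eq_sum, Polynomial.eval_eq_sum]
    exact Finset.sum_le_sum fun j _ => by dsimp only; gcongr
  refine ⟨(Polynomial.X + 1) * (p * q), fun m => ?_⟩
  let A : ℕ → Set (List α) := fun i => {w ∈ (L : Set (List α)) | w.length = i}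
  let B : ℕ → Set (List α) := fun i => {w ∈ (K : Set (List α)) | w.length = i}
  have hfin : ∀ i j, (A i ×ˢ B j).Finite := fun i j =>
    (L.finite_setOf_mem_and_length_eq i).prod (K.finite_setOf_mem_and_length_eq j)
  have hsub : {w ∈ ((L * K : Language α) : Set (List α)) | w.length = m} ⊆
      ⋃ i : Fin (m + 1), (fun z : List α × List α => z.1 ++ z.2) '' (A i ×ˢ B (m - i)) := by
    rintro w ⟨hw, hm⟩
    obtain ⟨x, hx, y, hy, rfl⟩ := mem_mul.1 hw
    rw [List.length_append] at hm
    exact Set.mem_iUnion.2 ⟨⟨x.length, by omega⟩, (x, y), ⟨⟨hx, rfl⟩, hy, by dsimp only; omega⟩, rfl⟩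
  simp only [Polynomial.eval_mul, Polynomial.eval_add, Polynomial.eval_X, Polynomial.eval_one]
  calc (L * K).growthCount m
      ≤ _ := Set.ncard_le_ncard hsub (Set.finite_iUnion fun i => (hfin _ _).image _)
    _ ≤ ∑ i : Fin (m + 1),
          ((fun z : List α × List α => z.1 ++ z.2) '' (A i ×ˢ B (m - i))).ncard :=
        Set.ncard_iUnion_le_of_fintype _
    _ ≤ ∑ _i : Fin (m + 1), p.eval m * q.eval m := by
        refine Finset.sum_le_sum fun i _ => (Set.ncard_image_le (hfin _ _)).trans ?_
        rw [Set.ncard_prod]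
        exact Nat.mul_le_mul ((hp i).trans (hmono p (by omega)))
          ((hq (m - i)).trans (hmono q (by omega)))
    _ = (m + 1) * (p.eval m * q.eval m) := by simp

theorem HasPolynomialGrowth.of_subsingleton {L : Language α}
    (h : ∀ x ∈ L, ∀ y ∈ L, x.length = y.length → x = y) : L.HasPolynomialGrowth := by
  refine ⟨1, fun m => ?_⟩
  rw [Polynomial.eval_one]
  have hsub : {w ∈ (L : Set (List α)) | w.length = m}.Subsingleton :=
    fun x hx y hy => h x hx.1 y hy.1 (hx.2.trans hy.2.symm)
  exact (Set.ncard_le_one hsub.finite).2 fun x hx y hy => hsub hx hy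

theorem hasPolynomialGrowth_singleton (w : List α) :
    ({w} : Language α).HasPolynomialGrowth :=
  .of_subsingleton fun _ hx _ hy _ => Eq.trans hx (Eq.symm hy)

theorem IsCommutativeLang.hasPolynomialGrowth {L : Language α} (h : L.IsCommutativeLang) :
    L.HasPolynomialGrowth := by
  obtain ⟨u, hu⟩ := h
  have hpow : ∀ x ∈ L, ∃ n : ℕ, x = (List.replicate n u).flatten := by
    intro x hx
    obtain ⟨S, rfl, hS⟩ := mem_kstar.1 (hu hx)
    exact ⟨S.length, congrArg _ (List.eq_replicate_of_mem hS)⟩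
  refine .of_subsingleton fun x hx y hy hxy => ?_
  obtain ⟨i, rfl⟩ := hpow x hx
  obtain ⟨j, rfl⟩ := hpow y hy
  by_cases hu0 : u = []
  · simp [hu0]
  · have hpos : 0 < u.length := List.length_pos_iff.2 hu0
    have hij : i * u.length = j * u.length := by simpa using hxy
    rw [Nat.eq_of_mul_eq_mul_right hpos hij]

/-- A language closed under concatenation with two distinct words of the same length `n` has at
least `2 ^ k` words of length `n * k`. -/
theorem two_pow_le_growthCount [Finite α] {L : Language α} (hnil : [] ∈ L)
    (happ : ∀ x ∈ L, ∀ y ∈ L, x ++ y ∈ L) {s t : List α} (hs : s ∈ L) (ht : t ∈ L)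
    (hst : s ≠ t) (hlen : t.length = s.length) (k : ℕ) :
    2 ^ k ≤ L.growthCount (s.length * k) := by
  induction k with
  | zero =>
    rw [pow_zero]
    exact (Set.ncard_pos (L.finite_setOf_mem_and_length_eq _)).2 ⟨[], hnil, by simp⟩
  | succ k ih =>
    set W := {w ∈ (L : Set (List α)) | w.length = s.length * k}
    have hfin : W.Finite := L.finite_setOf_mem_and_length_eq _
    have hdisj : Disjoint ((s ++ ·) '' W) ((t ++ ·) '' W) := by
      rw [Set.disjoint_left]
      rintro _ ⟨x, -, rfl⟩ ⟨y, -, hxy⟩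
      exact hst (List.append_inj_left hxy hlen).symm
    calc 2 ^ (k + 1) ≤ W.ncard + W.ncard := by rw [pow_succ, mul_two]; exact add_le_add ih ih
      _ = ((s ++ ·) '' W ∪ (t ++ ·) '' W).ncard := by
        rw [Set.ncard_union_eq hdisj (hfin.image _) (hfin.image _),
          Set.ncard_image_of_injective _ (List.append_right_injective s),
          Set.ncard_image_of_injective _ (List.append_right_injective t)]
      _ ≤ L.growthCount (s.length * (k + 1)) := by
        refine Set.ncard_le_ncard ?_ (L.finite_setOf_mem_and_length_eq _)
        rintro _ (⟨x, ⟨hx, hm⟩, rfl⟩ | ⟨x, ⟨hx, hm⟩, rfl⟩)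
        · exact ⟨happ s hs x hx, by simp only [List.length_append, hm]; ring⟩
        · exact ⟨happ t ht x hx, by simp only [List.length_append, hm, hlen]; ring⟩

end Language

/-- Exponentials eventually dominate polynomials. -/
theorem Polynomial.exists_eval_lt_two_pow (p : Polynomial ℕ) : ∃ k : ℕ, p.eval k < 2 ^ k := by
  have ho : (fun k : ℕ => ((p.eval k : ℕ) : ℝ)) =o[Filter.atTop] fun k : ℕ => (2 : ℝ) ^ k := by
    induction p using Polynomial.induction_on' with
    | add p q hp hq => simpa using hp.add hq
    | monomial n a =>
      simpa using (isLittleO_pow_const_const_pow_of_one_lt (R := ℝ) n one_lt_two).const_mul_left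
        (a : ℝ)
  obtain ⟨k, hk⟩ := (ho.bound (c := 1 / 2) (by norm_num)).exists
  refine ⟨k, ?_⟩
  have hpos : (0 : ℝ) < 2 ^ k := by positivity
  rw [Real.norm_of_nonneg (by positivity), Real.norm_of_nonneg hpos.le] at hk
  have : ((p.eval k : ℕ) : ℝ) < 2 ^ k := by linarith
  exact_mod_cast this

namespace NFA

variable {α σ : Type*} (M : NFA α σ)

variable {M} in
theorem mem_evalFrom_append {p q r : σ} {x y : List α} (hx : q ∈ M.evalFrom {p} x)
    (hy : r ∈ M.evalFrom {q} y) : r ∈ M.evalFrom {p} (x ++ y) := by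
  rw [evalFrom_append, mem_evalFrom_iff_exists]
  exact ⟨q, hx, hy⟩

variable {M} in
theorem mem_evalFrom_cons {p q : σ} {a : α} {x : List α} :
    q ∈ M.evalFrom {p} (a :: x) ↔ ∃ r ∈ M.step p a, q ∈ M.evalFrom {r} x := by
  rw [evalFrom_cons, stepSet_singleton, mem_evalFrom_iff_exists]

/-- `M.PathIn S p q w`: the word `w` labels a path of `M` from `p` to `q` visiting only states
in `S`. -/
inductive PathIn (S : Finset σ) : σ → σ → List α → Prop
  | nil {p : σ} (hp : p ∈ S) : PathIn S p p []
  | cons {p r q : σ} {a : α} {w : List α} (hp : p ∈ S) (hr : r ∈ M.step p a)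
      (h : PathIn S r q w) : PathIn S p q (a :: w)

/-- The language of labels of paths of `M` from `p` to `q` visiting only states in `S`. -/
def pathLang (S : Finset σ) (p q : σ) : Language α :=
  {w | M.PathIn S p q w}

variable {M}

theorem PathIn.mem {S : Finset σ} {p q : σ} {w : List α} (h : M.PathIn S p q w) : p ∈ S := by
  cases h <;> assumption

theorem pathIn_univ [Fintype σ] {p q : σ} {w : List α} (h : q ∈ M.evalFrom {p} w) :
    M.PathIn Finset.univ p q w := by
  induction w generalizing p with
  | nil =>
    obtain rfl : q = p := h
    exact .nil (Finset.mem_univ _)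
  | cons a w ih =>
    obtain ⟨r, hr, hq⟩ := mem_evalFrom_cons.1 h
    exact .cons (Finset.mem_univ _) hr (ih hq)

/-- A path either avoids the state `p` or can be split at its last visit to `p`. -/
theorem PathIn.erase_or_exists_last_visit [DecidableEq σ] {S : Finset σ} (p : σ) {s q : σ}
    {w : List α} (h : M.PathIn S s q w) :
    M.PathIn (S.erase p) s q w ∨ ∃ x y, w = x ++ y ∧ p ∈ M.evalFrom {s} x ∧
      (y = [] ∨ ∃ a z r, y = a :: z ∧ M.PathIn (S.erase p) r q z) := by
  induction h with
  | @nil s hs =>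
    by_cases hsp : s = p
    · exact .inr ⟨[], [], rfl, hsp.symm, .inl rfl⟩
    · exact .inl (.nil (Finset.mem_erase.2 ⟨hsp, hs⟩))
  | @cons s r q a w hs hr h ih =>
    rcases ih with ih | ⟨x, y, rfl, hx, hy⟩
    · by_cases hsp : s = p
      · exact .inr ⟨[], a :: w, rfl, hsp.symm, .inr ⟨a, w, r, rfl, ih⟩⟩
      · exact .inl (.cons (Finset.mem_erase.2 ⟨hsp, hs⟩) hr ih)
    · exact .inr ⟨a :: x, y, rfl, mem_evalFrom_cons.2 ⟨r, hr, hx⟩, hy⟩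

theorem pathLang_le [DecidableEq σ] (S : Finset σ) (p q : σ) :
    M.pathLang S p q ≤
      M.loopLang p * (1 + ⨆ a : α, ⨆ r : σ, {[a]} * M.pathLang (S.erase p) r q) := by
  intro w hw
  rcases PathIn.erase_or_exists_last_visit p hw with h | ⟨x, y, rfl, hx, hy⟩
  · exact absurd h.mem (Finset.notMem_erase p S)
  · refine Language.mem_mul.2 ⟨x, hx, y, ?_, rfl⟩
    rcases hy with rfl | ⟨a, z, r, rfl, hz⟩
    · exact .inl (Language.nil_mem_one)
    · exact .inr (Language.mem_iSup.2 ⟨a, Language.mem_iSup.2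
        ⟨r, Language.mem_mul.2 ⟨[a], rfl, z, hz, rfl⟩⟩⟩)

theorem pathLang_hasPolynomialGrowth [Finite α] [Finite σ]
    (h : ∀ q, (M.loopLang q).IsCommutativeLang) (S : Finset σ) (p q : σ) :
    (M.pathLang S p q).HasPolynomialGrowth := by
  classical
  induction S using Finset.strongInduction generalizing p with
  | H S ih =>
    by_cases hp : p ∈ S
    · exact ((h p).hasPolynomialGrowth.mul ((Language.hasPolynomialGrowth_singleton []).add
        (.iSup fun a => .iSup fun r => (Language.hasPolynomialGrowth_singleton [a]).mul
          (ih _ (Finset.erase_ssubset hp) r)))).mono (pathLang_le S p q)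
    · exact .of_subsingleton fun x hx => absurd (PathIn.mem hx) hp

theorem accepts_le_iSup_pathLang [Fintype σ] :
    M.accepts ≤ ⨆ s : σ, ⨆ f : σ, M.pathLang Finset.univ s f := by
  rintro w ⟨f, -, hf⟩
  obtain ⟨s, -, hs⟩ := mem_evalFrom_iff_exists.1 hf
  exact Language.mem_iSup.2 ⟨s, Language.mem_iSup.2 ⟨f, pathIn_univ hs⟩⟩

theorem growthCount_loopLang_le [Finite α] {q : σ} {x y : List α} (hx : q ∈ M.eval x)
    (hy : (M.evalFrom {q} y ∩ M.accept).Nonempty) (m : ℕ) :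
    (M.loopLang q).growthCount m ≤ M.accepts.growthCount (x.length + m + y.length) := by
  obtain ⟨f, hf, hfa⟩ := hy
  obtain ⟨s, hs, hsq⟩ := mem_evalFrom_iff_exists.1 hx
  refine Set.ncard_le_ncard_of_injOn (fun w => x ++ w ++ y) ?_ ?_
    (M.accepts.finite_setOf_mem_and_length_eq _)
  · rintro w ⟨hw, rfl⟩
    refine ⟨⟨f, hfa, mem_evalFrom_iff_exists.2 ⟨s, hs, ?_⟩⟩, by simp [add_assoc]⟩
    exact mem_evalFrom_append (mem_evalFrom_append hsq hw) hf
  · intro v _ w _ hvw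
    simpa using hvw

theorem loopLang_isCommutativeLang [Finite α] (hM : M.accepts.HasPolynomialGrowth) {q : σ}
    (hacc : M.Accessible q) (hcoacc : M.CoAccessible q) : (M.loopLang q).IsCommutativeLang := by
  obtain ⟨p, hp⟩ := hM
  obtain ⟨x, hx⟩ := hacc
  obtain ⟨y, hy⟩ := hcoacc
  refine Language.isCommutativeLang_of_append_comm fun s hs t ht => ?_
  by_contra hne
  have happ : ∀ u ∈ M.loopLang q, ∀ v ∈ M.loopLang q, u ++ v ∈ M.loopLang q :=
    fun _ hu _ hv => mem_evalFrom_append hu hv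
  obtain ⟨k, hk⟩ := Polynomial.exists_eval_lt_two_pow (p.comp (Polynomial.C x.length +
    Polynomial.C (s ++ t).length * Polynomial.X + Polynomial.C y.length))
  refine hk.not_ge ?_
  calc 2 ^ k ≤ (M.loopLang q).growthCount ((s ++ t).length * k) :=
        Language.two_pow_le_growthCount (Set.mem_singleton q) happ (happ s hs t ht)
          (happ t ht s hs) hne (by simp [add_comm]) k
    _ ≤ _ := growthCount_loopLang_le hx hy _
    _ ≤ _ := hp _
    _ = _ := by simp only [Polynomial.eval_comp, Polynomial.eval_add, Polynomial.eval_mul,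
                  Polynomial.eval_C, Polynomial.eval_X]

end NFA

/-- For an NFA `M` (with start state `q₀`) in which every state is accessible and
co-accessible, `L(M)` has polynomial growth if and only if every language `L_q` is
commutative. -/
theorem hasPolynomialGrowth_iff_loopLang_isCommutative {α σ : Type*} [Fintype α] [Fintype σ]
    (M : NFA α σ) (q₀ : σ) (hstart : M.start = {q₀})
    (hacc : ∀ q : σ, M.Accessible q) (hcoacc : ∀ q : σ, M.CoAccessible q) :
    M.accepts.HasPolynomialGrowth ↔ ∀ q : σ, (M.loopLang q).IsCommutativeLang := by
  refine ⟨fun h q => NFA.loopLang_isCommutativeLang h (hacc q) (hcoacc q), fun h => ?_⟩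
  exact (Language.HasPolynomialGrowth.iSup fun s => .iSup fun f =>
    NFA.pathLang_hasPolynomialGrowth h Finset.univ s f).mono NFA.accepts_le_iSup_pathLang
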